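/- (Corollary of the discussion) Let A be a finite family of n rectangles with widths wᵢ and heights lᵢ, and let M₀ be a positioning of A with T(M₀) = T₀(A). For Δx > 0, let A_{Δx} denote the family obtained from A by replacing w₁ with w₁ + Δx. Then for every Δx > 0, η₀(A_{Δx}) ≥ min(η₀(A), l₁/q(M₀)); in particular, there is a positive constant c > 0, independent of Δx, such that η₀(A_{Δx}) ≥ c for all Δx > 0 (as one side of a rectangle expands, the best packing efficiency can never approach zero). -/

import Mathlib

open Set Finset Function

/-- A positioning of a family of rectangles (widths `w`, heights `l`) assigns
lower-left corners `(a i, b i)` so that the open interiors are pairwise disjoint. -/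
def IsPositioning {ι : Type*} (w l a b : ι → ℝ) : Prop :=
  ∀ i j, i ≠ j →
    Disjoint (Set.Ioo (a i) (a i + w i) ×ˢ Set.Ioo (b i) (b i + l i))
             (Set.Ioo (a j) (a j + w j) ×ˢ Set.Ioo (b j) (b j + l j))

/-- Horizontal extent `p(M) = max_{i,j} ((a i + w i) - a j)`. -/
noncomputable def pval {n : ℕ} (w a : Fin n → ℝ) : ℝ :=
  ⨆ i, ⨆ j, (a i + w i - a j)

/-- Vertical extent `q(M) = max_{i,j} ((b i + l i) - b j)`. -/
noncomputable def qval {n : ℕ} (l b : Fin n → ℝ) : ℝ :=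
  ⨆ i, ⨆ j, (b i + l i - b j)

/-- Bounding area `T(M) = p(M) * q(M)`. -/
noncomputable def Tval {n : ℕ} (w l a b : Fin n → ℝ) : ℝ :=
  pval w a * qval l b

/-- Total area `S(A) = ∑ i, w i * l i`. -/
noncomputable def Sval {n : ℕ} (w l : Fin n → ℝ) : ℝ :=
  ∑ i, w i * l i

/-- Packing efficiency `η(M) = S(A) / T(M)`. -/
noncomputable def eta {n : ℕ} (w l a b : Fin n → ℝ) : ℝ :=
  Sval w l / Tval w l a b

/-- Best packing efficiency `η₀(A) = sup over positionings M of η(M)`. -/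
noncomputable def eta0 {n : ℕ} (w l : Fin n → ℝ) : ℝ :=
  sSup {e | ∃ a b : Fin n → ℝ, IsPositioning w l a b ∧ e = eta w l a b}

/-- Minimal bounding area `T₀(A) = inf over positionings M of T(M)`. -/
noncomputable def T0 {n : ℕ} (w l : Fin n → ℝ) : ℝ :=
  sInf {t | ∃ a b : Fin n → ℝ, IsPositioning w l a b ∧ t = Tval w l a b}

theorem disjoint_Ioo_add_iff {a b u v : ℝ} (hu : 0 < u) (hv : 0 < v) :
    Disjoint (Set.Ioo a (a + u)) (Set.Ioo b (b + v)) ↔ a + u ≤ b ∨ b + v ≤ a := by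
  rw [Set.Ioo_disjoint_Ioo, min_le_iff, le_max_iff, le_max_iff]
  grind

theorem isPositioning_iff {ι : Type*} {w l : ι → ℝ} (hw : ∀ i, 0 < w i) (hl : ∀ i, 0 < l i)
    (a b : ι → ℝ) :
    IsPositioning w l a b ↔ ∀ i j, i ≠ j →
      (a i + w i ≤ a j ∨ a j + w j ≤ a i) ∨ (b i + l i ≤ b j ∨ b j + l j ≤ b i) := by
  simp only [IsPositioning, Set.disjoint_prod, disjoint_Ioo_add_iff (hw _) (hw _),
    disjoint_Ioo_add_iff (hl _) (hl _)]

theorem le_pval {n : ℕ} (w a : Fin n → ℝ) (i j : Fin n) : a i + w i - a j ≤ pval w a :=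
  (le_ciSup (f := fun j => a i + w i - a j) (Set.finite_range _).bddAbove j).trans
    (le_ciSup (f := fun i => ⨆ j, (a i + w i - a j)) (Set.finite_range _).bddAbove i)

theorem pval_le {n : ℕ} {w a : Fin (n + 1) → ℝ} {c : ℝ} (h : ∀ i j, a i + w i - a j ≤ c) :
    pval w a ≤ c :=
  ciSup_le fun i => ciSup_le fun j => h i j

theorem width_le_pval {n : ℕ} (w a : Fin n → ℝ) (i : Fin n) : w i ≤ pval w a := by
  linarith [le_pval w a i i]

theorem height_le_qval {n : ℕ} (l b : Fin n → ℝ) (i : Fin n) : l i ≤ qval l b :=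
  width_le_pval l b i

theorem mul_le_Tval {n : ℕ} {w l : Fin n → ℝ} (hw : ∀ i, 0 < w i) (hl : ∀ i, 0 < l i)
    (a b : Fin n → ℝ) (i : Fin n) : w i * l i ≤ Tval w l a b :=
  mul_le_mul (width_le_pval w a i) (height_le_qval l b i) (hl i).le
    ((hw i).le.trans (width_le_pval w a i))

theorem Sval_pos {n : ℕ} {w l : Fin (n + 1) → ℝ} (hw : ∀ i, 0 < w i) (hl : ∀ i, 0 < l i) :
    0 < Sval w l :=
  Finset.sum_pos (fun i _ => mul_pos (hw i) (hl i)) Finset.univ_nonempty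

theorem eta_le_eta0 {n : ℕ} {w l : Fin (n + 1) → ℝ} (hw : ∀ i, 0 < w i) (hl : ∀ i, 0 < l i)
    {a b : Fin (n + 1) → ℝ} (h : IsPositioning w l a b) : eta w l a b ≤ eta0 w l := by
  refine le_csSup ⟨Sval w l / (w 0 * l 0), ?_⟩ ⟨a, b, h, rfl⟩
  rintro _ ⟨a', b', -, rfl⟩
  exact div_le_div_of_nonneg_left (Sval_pos hw hl).le (mul_pos (hw 0) (hl 0))
    (mul_le_Tval hw hl a' b' 0)

theorem T0_le_Tval {n : ℕ} {w l : Fin (n + 1) → ℝ} (hw : ∀ i, 0 < w i) (hl : ∀ i, 0 < l i)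
    {a b : Fin (n + 1) → ℝ} (h : IsPositioning w l a b) : T0 w l ≤ Tval w l a b := by
  refine csInf_le ⟨w 0 * l 0, ?_⟩ ⟨a, b, h, rfl⟩
  rintro _ ⟨a', b', -, rfl⟩
  exact mul_le_Tval hw hl a' b' 0

/-- A positioning of minimal bounding area has maximal packing efficiency. -/
theorem eta0_le_eta_of_Tval_eq_T0 {n : ℕ} {w l : Fin (n + 1) → ℝ} (hw : ∀ i, 0 < w i)
    (hl : ∀ i, 0 < l i) {a b : Fin (n + 1) → ℝ} (h : IsPositioning w l a b)
    (hopt : Tval w l a b = T0 w l) : eta0 w l ≤ eta w l a b := by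
  refine csSup_le ⟨_, a, b, h, rfl⟩ ?_
  rintro _ ⟨a', b', h', rfl⟩
  exact div_le_div_of_nonneg_left (Sval_pos hw hl).le
    ((mul_pos (hw 0) (hl 0)).trans_le (mul_le_Tval hw hl a b 0))
    (hopt ▸ T0_le_Tval hw hl h')

theorem update_add_pos {n : ℕ} {w : Fin (n + 1) → ℝ} (hw : ∀ i, 0 < w i) {d : ℝ} (hd : 0 < d)
    (i : Fin (n + 1)) : 0 < Function.update w 0 (w 0 + d) i := by
  have := hw 0
  have := hw i
  rw [Function.update_apply]
  split_ifs <;> linarith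

theorem Sval_update {n : ℕ} (w l : Fin (n + 1) → ℝ) (d : ℝ) :
    Sval (Function.update w 0 (w 0 + d)) l = Sval w l + d * l 0 := by
  simp only [Sval, Fin.sum_univ_succ, Function.update_self,
    Function.update_of_ne (Fin.succ_ne_zero _)]
  ring

/-- Shift by `d` to the right every rectangle lying to the right of rectangle `0`. -/
noncomputable def shiftRight {n : ℕ} (w a : Fin (n + 1) → ℝ) (d : ℝ) (i : Fin (n + 1)) : ℝ :=
  if a 0 + w 0 ≤ a i then a i + d else a i

theorem IsPositioning.shiftRight {n : ℕ} {w l a b : Fin (n + 1) → ℝ} (hw : ∀ i, 0 < w i)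
    (hl : ∀ i, 0 < l i) (h : IsPositioning w l a b) {d : ℝ} (hd : 0 < d) :
    IsPositioning (Function.update w 0 (w 0 + d)) l (shiftRight w a d) b := by
  rw [isPositioning_iff hw hl] at h
  rw [isPositioning_iff (update_add_pos hw hd) hl]
  intro i j hij
  have hi := hw i
  have hj := hw j
  rcases h i j hij with h | h
  · left
    simp only [_root_.shiftRight, Function.update_apply]
    grind
  · exact Or.inr h

theorem pval_shiftRight_le {n : ℕ} {w : Fin (n + 1) → ℝ} (hw : ∀ i, 0 < w i)
    (a : Fin (n + 1) → ℝ) {d : ℝ} (hd : 0 < d) :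
    pval (Function.update w 0 (w 0 + d)) (shiftRight w a d) ≤ pval w a + d := by
  refine pval_le fun i j => ?_
  have := le_pval w a i j
  have := hw 0
  simp only [shiftRight, Function.update_apply]
  grind

theorem min_eta_le_eta0_update {n : ℕ} {w l a b : Fin (n + 1) → ℝ} (hw : ∀ i, 0 < w i)
    (hl : ∀ i, 0 < l i) (h : IsPositioning w l a b) {d : ℝ} (hd : 0 < d) :
    min (eta w l a b) (l 0 / qval l b) ≤ eta0 (Function.update w 0 (w 0 + d)) l := by
  have hw' := update_add_pos hw hd
  refine le_trans ?_ (eta_le_eta0 hw' hl (h.shiftRight hw hl hd))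
  have hq : 0 < qval l b := (hl 0).trans_le (height_le_qval l b 0)
  have hp : 0 < pval w a := (hw 0).trans_le (width_le_pval w a 0)
  have hp' : 0 < pval (Function.update w 0 (w 0 + d)) (shiftRight w a d) :=
    (hw' 0).trans_le (width_le_pval _ _ 0)
  set m := min (eta w l a b) (l 0 / qval l b)
  have hm0 : 0 ≤ m :=
    le_min (div_nonneg (Sval_pos hw hl).le (mul_pos hp hq).le) (div_nonneg (hl 0).le hq.le)
  have hS : m * (pval w a * qval l b) ≤ Sval w l :=
    (le_div_iff₀ (mul_pos hp hq)).1 (min_le_left _ _)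
  have hl0 : m * qval l b ≤ l 0 := (le_div_iff₀ hq).1 (min_le_right _ _)
  rw [eta, Tval, le_div_iff₀ (mul_pos hp' hq), Sval_update]
  calc m * (pval (Function.update w 0 (w 0 + d)) (shiftRight w a d) * qval l b)
      ≤ m * ((pval w a + d) * qval l b) := by
        gcongr
        exact pval_shiftRight_le hw a hd
    _ = m * (pval w a * qval l b) + d * (m * qval l b) := by ring
    _ ≤ Sval w l + d * l 0 := by gcongr

/-- Corollary of the discussion: as the first width expands by any
`Δx > 0`, the best packing efficiency stays at least `min(η₀(A), l₁/q(M₀))`; in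
particular it is bounded below by a positive constant independent of `Δx`. -/
theorem eta0_lower_bound_under_expansion {n : ℕ} (w l : Fin (n + 1) → ℝ)
    (hw : ∀ i, 0 < w i) (hl : ∀ i, 0 < l i)
    (a₀ b₀ : Fin (n + 1) → ℝ) (hM₀ : IsPositioning w l a₀ b₀)
    (hopt : Tval w l a₀ b₀ = T0 w l) :
    (∀ Δx : ℝ, 0 < Δx →
      min (eta0 w l) (l 0 / qval l b₀) ≤ eta0 (Function.update w 0 (w 0 + Δx)) l) ∧
    ∃ c : ℝ, 0 < c ∧ ∀ Δx : ℝ, 0 < Δx →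
      c ≤ eta0 (Function.update w 0 (w 0 + Δx)) l := by
  refine ⟨fun d hd => ?_, min (eta w l a₀ b₀) (l 0 / qval l b₀), ?_, fun d hd =>
    min_eta_le_eta0_update hw hl hM₀ hd⟩
  · exact (min_le_min_right _ (eta0_le_eta_of_Tval_eq_T0 hw hl hM₀ hopt)).trans
      (min_eta_le_eta0_update hw hl hM₀ hd)
  · exact lt_min
      (div_pos (Sval_pos hw hl)
        ((mul_pos (hw 0) (hl 0)).trans_le (mul_le_Tval hw hl a₀ b₀ 0)))
      (div_pos (hl 0) ((hl 0).trans_le (height_le_qval l b₀ 0)))
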